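/- If P ⊆ B(n) is a maximal intersecting family, then A = {ID(p) : p ∈ min(P)} is a maximal intersecting antichain: A is an antichain under inclusion, any two members of A have nonempty intersection, and for every set B ∉ A there exists A ∈ A with either A ∩ B = ∅ or A ⊆ B. -/

import Mathlib

/-- The inversion set of a permutation `p` of `{0,…,n-1}` (0-indexed version of
`Inv(p) = {(p_j, p_i) : i < j, p_j < p_i}`): pairs `(a, b)` of values with `a < b`
such that `b` precedes `a` in the one-line notation of `p`. -/
def InvSet (n : ℕ) (p : Equiv.Perm (Fin n)) : Finset (Fin n × Fin n) :=
  Finset.univ.filter (fun x => x.1 < x.2 ∧ p.symm x.2 < p.symm x.1)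

/-- The weak (right) Bruhat order: `p ≼ q` iff `Inv(p) ⊆ Inv(q)`. -/
def BLE {n : ℕ} (p q : Equiv.Perm (Fin n)) : Prop :=
  InvSet n p ⊆ InvSet n q

/-- The rank of a permutation in the weak Bruhat order: `rank(p) = |Inv(p)|`. -/
def brank (n : ℕ) (p : Equiv.Perm (Fin n)) : ℕ :=
  (InvSet n p).card

/-- The inverse descent set `ID(p) ⊆ {1,…,n-1}`: `i ∈ ID(p)` iff the (1-indexed)
value `i+1` precedes the value `i` in the one-line notation of `p`.  Here the
1-indexed value `v ∈ {1,…,n}` corresponds to the element of `Fin n` with `val = v - 1`. -/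
def ID (n : ℕ) (p : Equiv.Perm (Fin n)) : Finset ℕ :=
  (Finset.Icc 1 (n - 1)).filter
    (fun i => ∃ a b : Fin n, (a : ℕ) + 1 = i ∧ (b : ℕ) = i ∧ p.symm b < p.symm a)

/-- The generator `g i` is the adjacent transposition interchanging the
(1-indexed) values `i` and `i+1`. -/
def g (n i : ℕ) : Equiv.Perm (Fin n) :=
  if h : 1 ≤ i ∧ i < n then Equiv.swap ⟨i - 1, by omega⟩ ⟨i, h.2⟩ else 1

/-- A family of permutations is intersecting if any two of its members have
meet different from the identity in the weak Bruhat lattice; equivalently (since the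
identity is the minimum), any two members have a common lower bound distinct
from the identity. -/
def BInter (n : ℕ) (P : Set (Equiv.Perm (Fin n))) : Prop :=
  ∀ p ∈ P, ∀ q ∈ P, ∃ r : Equiv.Perm (Fin n), r ≠ 1 ∧ BLE r p ∧ BLE r q

/-- A maximal intersecting family: intersecting, and every permutation
intersecting all its members belongs to it. -/
def MaxBInter (n : ℕ) (P : Set (Equiv.Perm (Fin n))) : Prop :=
  BInter n P ∧ ∀ q : Equiv.Perm (Fin n),
    (∀ p ∈ P, ∃ r : Equiv.Perm (Fin n), r ≠ 1 ∧ BLE r q ∧ BLE r p) → q ∈ P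

/-- The set of `≼`-minimal elements of a family `P`. -/
def minSet (n : ℕ) (P : Set (Equiv.Perm (Fin n))) : Set (Equiv.Perm (Fin n)) :=
  {p | p ∈ P ∧ ∀ q ∈ P, BLE q p → q = p}

/-- `m` is the meet (greatest lower bound) of `p` and `q` in the weak Bruhat order. -/
def IsMeetB (n : ℕ) (p q m : Equiv.Perm (Fin n)) : Prop :=
  BLE m p ∧ BLE m q ∧ ∀ r, BLE r p → BLE r q → BLE r m

/-- `m` is the join (least upper bound) of the set `S` in the weak Bruhat order. -/
def IsLUBB (n : ℕ) (S : Set (Equiv.Perm (Fin n))) (m : Equiv.Perm (Fin n)) : Prop :=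
  (∀ s ∈ S, BLE s m) ∧ ∀ u, (∀ s ∈ S, BLE s u) → BLE m u

/-- For a system `𝒜` of subsets of `{1,…,n-1}`,
`P(𝒜) = {p : A ⊆ ID(p) for some A ∈ 𝒜}`. -/
def PofSystem (n : ℕ) (𝒜 : Set (Finset ℕ)) : Set (Equiv.Perm (Fin n)) :=
  {p | ∃ A ∈ 𝒜, A ⊆ ID n p}

/-- The generating set system of a family `P`: `{ID(p) : p ∈ min(P)}`. -/
def genSys (n : ℕ) (P : Set (Equiv.Perm (Fin n))) : Set (Finset ℕ) :=
  {A | ∃ p ∈ minSet n P, ID n p = A}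

/-- A maximal intersecting antichain of subsets of `{1,…,n-1}`: an antichain
under inclusion, any two members of which meet, such that for every subset `B`
of `{1,…,n-1}` not in the system there is a member `A` with `A ∩ B = ∅` or `A ⊆ B`. -/
def MIA (n : ℕ) (𝒜 : Set (Finset ℕ)) : Prop :=
  (∀ A ∈ 𝒜, ∀ B ∈ 𝒜, A ⊆ B → A = B) ∧
  (∀ A ∈ 𝒜, ∀ B ∈ 𝒜, (A ∩ B).Nonempty) ∧
  (∀ B : Finset ℕ, B ⊆ Finset.Icc 1 (n - 1) → B ∉ 𝒜 → ∃ A ∈ 𝒜, A ∩ B = ∅ ∨ A ⊆ B)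

theorem mem_InvSet {n : ℕ} {p : Equiv.Perm (Fin n)} {a b : Fin n} :
    (a, b) ∈ InvSet n p ↔ a < b ∧ p.symm b < p.symm a := by
  simp [InvSet]

theorem mem_ID_iff {n : ℕ} {p : Equiv.Perm (Fin n)} {i : ℕ} :
    i ∈ ID n p ↔ ∃ a b : Fin n, (a : ℕ) + 1 = i ∧ (b : ℕ) = i ∧ (a, b) ∈ InvSet n p := by
  simp only [ID, Finset.mem_filter, Finset.mem_Icc, mem_InvSet, Fin.lt_def]
  constructor
  · rintro ⟨-, a, b, ha, hb, h⟩
    exact ⟨a, b, ha, hb, by omega, h⟩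
  · rintro ⟨a, b, ha, hb, -, h⟩
    exact ⟨by omega, a, b, ha, hb, h⟩

theorem ID_subset_Icc (n : ℕ) (p : Equiv.Perm (Fin n)) : ID n p ⊆ Finset.Icc 1 (n - 1) :=
  Finset.filter_subset _ _

theorem ID_mono {n : ℕ} {p q : Equiv.Perm (Fin n)} (h : BLE p q) : ID n p ⊆ ID n q := by
  intro i hi
  obtain ⟨a, b, ha, hb, hab⟩ := mem_ID_iff.1 hi
  exact mem_ID_iff.2 ⟨a, b, ha, hb, h hab⟩

/-- A transitive relation holding between consecutive elements of the interval `[a, b]`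
of `Fin n` relates `a` to `b`. -/
theorem Fin.rel_of_forall_consecutive {n : ℕ} {R : Fin n → Fin n → Prop}
    (htrans : ∀ a b c, R a b → R b c → R a c) {a b : Fin n} (hab : a < b)
    (h : ∀ u v : Fin n, (u : ℕ) + 1 = v → a ≤ u → v ≤ b → R u v) : R a b := by
  obtain ⟨b, hb⟩ := b
  induction b with
  | zero => simp [Fin.lt_def] at hab
  | succ k ih =>
    have hak : (a : ℕ) ≤ k := Nat.lt_succ_iff.1 hab
    have hstep := h ⟨k, by omega⟩ ⟨k + 1, hb⟩ rfl hak le_rfl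
    rcases eq_or_lt_of_le hak with e | e
    · have : a = ⟨k, by omega⟩ := Fin.ext e
      rwa [this]
    · refine htrans _ _ _ (ih (by omega) e fun u v huv hu hv => h u v huv hu ?_) hstep
      exact hv.trans (Nat.le_succ k)

theorem Equiv.Perm.eq_of_forall_symm_lt_iff {n : ℕ} {p q : Equiv.Perm (Fin n)}
    (h : ∀ a b, p.symm a < p.symm b ↔ q.symm a < q.symm b) : p = q := by
  have hmono : ∀ {a b}, (q.trans p.symm) a ≤ (q.trans p.symm) b ↔ a ≤ b := by
    intro a b
    rw [← not_lt, ← not_lt]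
    simpa using not_congr (h (q b) (q a))
  have he : (⟨q.trans p.symm, hmono⟩ : Fin n ≃o Fin n) = OrderIso.refl _ :=
    Subsingleton.elim _ _
  ext a
  have := congrArg (fun e : Fin n ≃o Fin n => p (e a)) he
  simpa using congrArg Fin.val this.symm

theorem InvSet_injective (n : ℕ) : Function.Injective (InvSet n) := by
  intro p q h
  have key : ∀ a b : Fin n, a < b → (p.symm b < p.symm a ↔ q.symm b < q.symm a) := by
    intro a b hab
    have := congrArg ((a, b) ∈ ·) h
    simpa [mem_InvSet, hab] using this
  refine Equiv.Perm.eq_of_forall_symm_lt_iff fun a b => ?_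
  rcases lt_trichotomy a b with hab | rfl | hab
  · have hp := p.symm.injective.ne hab.ne
    have hq := q.symm.injective.ne hab.ne
    have := not_congr (key a b hab)
    rwa [not_lt, not_lt, hp.le_iff_lt, hq.le_iff_lt] at this
  · simp
  · exact key b a hab

theorem ID_nonempty_of_ne_one {n : ℕ} {p : Equiv.Perm (Fin n)} (hp : p ≠ 1) :
    (ID n p).Nonempty := by
  by_contra hne
  rw [Finset.not_nonempty_iff_eq_empty] at hne
  have hmono : StrictMono p.symm := fun a b hab =>
    Fin.rel_of_forall_consecutive (R := fun a b => p.symm a < p.symm b)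
      (fun _ _ _ => lt_trans) hab fun u v huv _ _ => by
        by_contra hlt
        have hne' : u ≠ v := by rintro rfl; omega
        have hvu := lt_of_le_of_ne (not_lt.1 hlt) (p.symm.injective.ne hne'.symm)
        have : (v : ℕ) ∈ ID n p :=
          mem_ID_iff.2 ⟨u, v, huv, rfl, mem_InvSet.2 ⟨by rw [Fin.lt_def]; omega, hvu⟩⟩
        simp [hne] at this
  exact hp (Equiv.Perm.eq_of_forall_symm_lt_iff fun a b => by
    rw [hmono.lt_iff_lt]; rfl)

/-- The number of positive integers up to `v` outside `B`. -/
def gapCount (B : Finset ℕ) (v : ℕ) : ℕ :=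
  (Finset.Icc 1 v \ B).card

theorem gapCount_mono (B : Finset ℕ) : Monotone (gapCount B) := fun _ _ h =>
  Finset.card_le_card (Finset.sdiff_subset_sdiff (Finset.Icc_subset_Icc_right h) le_rfl)

theorem gapCount_eq_iff {B : Finset ℕ} {a b : ℕ} (hab : a ≤ b) :
    gapCount B a = gapCount B b ↔ Finset.Ioc a b ⊆ B := by
  have hsub : Finset.Icc 1 a \ B ⊆ Finset.Icc 1 b \ B :=
    Finset.sdiff_subset_sdiff (Finset.Icc_subset_Icc_right hab) le_rfl
  constructor
  · intro h i hi
    have heq := Finset.eq_of_subset_of_card_le hsub h.ge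
    by_contra hiB
    have hi' := Finset.mem_Ioc.1 hi
    have : i ∈ Finset.Icc 1 a \ B := by
      rw [heq]
      simp [hiB]
      omega
    simp at this
    omega
  · intro h
    refine congrArg Finset.card (Finset.Subset.antisymm hsub fun i hi => ?_)
    simp only [Finset.mem_sdiff, Finset.mem_Icc] at hi ⊢
    refine ⟨⟨hi.1.1, ?_⟩, hi.2⟩
    by_contra hia
    exact hi.2 (h (Finset.mem_Ioc.2 ⟨by omega, hi.1.2⟩))

/-- Sorting key that keeps the blocks of `B` in order and reverses each of them. -/
def blockKey (n : ℕ) (B : Finset ℕ) (v : Fin n) : ℕ ×ₗ (Fin n)ᵒᵈ :=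
  toLex (gapCount B v, OrderDual.toDual v)

/-- The permutation reversing each maximal run of values linked by members of `B`;
it is the least permutation whose inverse descent set contains `B`. -/
def blockReversal (n : ℕ) (B : Finset ℕ) : Equiv.Perm (Fin n) :=
  Tuple.sort (blockKey n B)

theorem blockReversal_symm_lt_iff {n : ℕ} {B : Finset ℕ} {a b : Fin n} :
    (blockReversal n B).symm a < (blockReversal n B).symm b ↔
      blockKey n B a < blockKey n B b := by
  have hinj : Function.Injective (blockKey n B) := fun a b h => by
    simpa using (Prod.ext_iff.1 (toLex.injective h)).2
  have hmono : StrictMono (blockKey n B ∘ blockReversal n B) :=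
    (Tuple.monotone_sort _).strictMono_of_injective
      (hinj.comp (blockReversal n B).injective)
  simpa using (hmono.lt_iff_lt (a := (blockReversal n B).symm a)
    (b := (blockReversal n B).symm b)).symm

theorem mem_InvSet_blockReversal {n : ℕ} {B : Finset ℕ} {a b : Fin n} :
    (a, b) ∈ InvSet n (blockReversal n B) ↔ a < b ∧ Finset.Ioc (a : ℕ) b ⊆ B := by
  rw [mem_InvSet, blockReversal_symm_lt_iff]
  refine and_congr_right fun hab => ?_
  have hle : (a : ℕ) ≤ b := le_of_lt hab
  have := gapCount_mono B hle
  rw [← gapCount_eq_iff hle, blockKey, blockKey, Prod.Lex.toLex_lt_toLex]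
  simp only [OrderDual.toDual_lt_toDual, hab, and_true]
  omega

theorem ID_blockReversal {n : ℕ} {B : Finset ℕ} (hB : B ⊆ Finset.Icc 1 (n - 1)) :
    ID n (blockReversal n B) = B := by
  ext i
  rw [mem_ID_iff]
  simp only [mem_InvSet_blockReversal]
  constructor
  · rintro ⟨a, b, ha, hb, -, hsub⟩
    exact hsub (Finset.mem_Ioc.2 (by omega))
  · intro hi
    have hi' := Finset.mem_Icc.1 (hB hi)
    refine ⟨⟨i - 1, by omega⟩, ⟨i, by omega⟩, by simp; omega, rfl, ?_, fun j hj => ?_⟩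
    · rw [Fin.lt_def]
      simp
      omega
    · simp at hj
      rwa [show j = i by omega]

theorem blockReversal_le {n : ℕ} {B : Finset ℕ} {q : Equiv.Perm (Fin n)} (h : B ⊆ ID n q) :
    BLE (blockReversal n B) q := by
  rintro ⟨a, b⟩ hab
  obtain ⟨hlt, hsub⟩ := mem_InvSet_blockReversal.1 hab
  refine mem_InvSet.2 ⟨hlt, Fin.rel_of_forall_consecutive (R := fun a b => q.symm b < q.symm a)
    (fun _ _ _ h₁ h₂ => h₂.trans h₁) hlt fun u v huv hu hv => ?_⟩
  rw [Fin.le_def] at hu hv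
  obtain ⟨u', v', hu', hv', hinv⟩ :=
    mem_ID_iff.1 (h (hsub (Finset.mem_Ioc.2 (⟨by omega, hv⟩ : (a : ℕ) < v ∧ (v : ℕ) ≤ b))))
  have hu'' : u' = u := Fin.ext (by omega)
  have hv'' : v' = v := Fin.ext hv'
  subst hu'' hv''
  exact (mem_InvSet.1 hinv).2

/-- Two permutations have a nontrivial common lower bound iff they share an inverse descent. -/
theorem exists_ne_one_le_le_iff {n : ℕ} {p q : Equiv.Perm (Fin n)} :
    (∃ r : Equiv.Perm (Fin n), r ≠ 1 ∧ BLE r p ∧ BLE r q) ↔ (ID n p ∩ ID n q).Nonempty := by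
  constructor
  · rintro ⟨r, hr, hp, hq⟩
    exact (ID_nonempty_of_ne_one hr).mono (Finset.subset_inter (ID_mono hp) (ID_mono hq))
  · intro h
    refine ⟨blockReversal n (ID n p ∩ ID n q), fun h₁ => ?_,
      blockReversal_le Finset.inter_subset_left, blockReversal_le Finset.inter_subset_right⟩
    have hID := ID_blockReversal (Finset.inter_subset_left.trans (ID_subset_Icc n p) :
      ID n p ∩ ID n q ⊆ _)
    rw [← hID, h₁] at h
    obtain ⟨i, hi⟩ := h
    obtain ⟨a, b, -, -, hab⟩ := mem_ID_iff.1 hi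
    obtain ⟨hlt, hgt⟩ := mem_InvSet.1 hab
    exact lt_asymm hlt hgt

theorem exists_mem_minSet_le {n : ℕ} {P : Set (Equiv.Perm (Fin n))} {p : Equiv.Perm (Fin n)}
    (hp : p ∈ P) : ∃ m ∈ minSet n P, BLE m p := by
  obtain ⟨m, ⟨hmP, hmp⟩, hmin⟩ := Set.exists_min_image {q | q ∈ P ∧ BLE q p} (brank n)
    (Set.toFinite _) ⟨p, hp, Finset.Subset.refl _⟩
  refine ⟨m, ⟨hmP, fun q hq hqm => InvSet_injective n ?_⟩, hmp⟩
  exact Finset.eq_of_subset_of_card_le hqm (hmin q ⟨hq, Finset.Subset.trans hqm hmp⟩)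

theorem MaxBInter.mem_of_ID_subset {n : ℕ} {P : Set (Equiv.Perm (Fin n))} (hP : MaxBInter n P)
    {p q : Equiv.Perm (Fin n)} (hp : p ∈ P) (h : ID n p ⊆ ID n q) : q ∈ P :=
  hP.2 q fun r hr => exists_ne_one_le_le_iff.2 <|
    (exists_ne_one_le_le_iff.1 (hP.1 p hp r hr)).mono (Finset.inter_subset_inter_right h)

theorem MaxBInter.blockReversal_ID_eq {n : ℕ} {P : Set (Equiv.Perm (Fin n))}
    (hP : MaxBInter n P) {p : Equiv.Perm (Fin n)} (hp : p ∈ minSet n P) :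
    blockReversal n (ID n p) = p :=
  hp.2 _ (hP.mem_of_ID_subset hp.1 (ID_blockReversal (ID_subset_Icc n p)).ge)
    (blockReversal_le (Finset.Subset.refl _))

/-- If `P ⊆ B(n)` is a maximal intersecting family, then `{ID(p) : p ∈ min(P)}`
is a maximal intersecting antichain. -/
theorem stmt_12 (n : ℕ) (P : Set (Equiv.Perm (Fin n))) (hP : MaxBInter n P) :
    MIA n (genSys n P) := by
  refine ⟨?_, ?_, fun B hB _ => ?_⟩
  · rintro _ ⟨p, hp, rfl⟩ _ ⟨q, hq, rfl⟩ hpq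
    have hle := blockReversal_le hpq
    rw [hP.blockReversal_ID_eq hp] at hle
    rw [hq.2 p hp.1 hle]
  · rintro _ ⟨p, hp, rfl⟩ _ ⟨q, hq, rfl⟩
    exact exists_ne_one_le_le_iff.1 (hP.1 p hp.1 q hq.1)
  · by_cases hdisj : ∃ A ∈ genSys n P, A ∩ B = ∅
    · obtain ⟨A, hA, hAB⟩ := hdisj
      exact ⟨A, hA, Or.inl hAB⟩
    · push Not at hdisj
      have hmem : blockReversal n B ∈ P := hP.2 _ fun p hp => by
        obtain ⟨m, hm, hmp⟩ := exists_mem_minSet_le hp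
        rw [exists_ne_one_le_le_iff, ID_blockReversal hB, Finset.inter_comm]
        exact (hdisj _ ⟨m, hm, rfl⟩).mono (Finset.inter_subset_inter_right (ID_mono hmp))
      obtain ⟨m, hm, hle⟩ := exists_mem_minSet_le hmem
      exact ⟨ID n m, ⟨m, hm, rfl⟩, Or.inr ((ID_mono hle).trans (ID_blockReversal hB).le)⟩
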